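/- Let Ã be an invertible n×n real matrix, L an n×k real matrix whose Gram matrix LᵀL is invertible, and R a k×n real matrix, and assume Â = Ã + L·R is invertible. With L† = (LᵀL)⁻¹Lᵀ and W = I_k + R·Ã⁻¹·L, the following norm bounds hold in the spectral norm: ‖W‖ ≤ ‖L†‖·‖Â‖·‖Ã⁻¹‖·‖L‖ and ‖W⁻¹‖ ≤ ‖L†‖·‖Â⁻¹‖·‖Ã‖·‖L‖. -/

import Mathlib

open Matrix

/-- The spectral norm of a real matrix: the operator norm of the induced linear map
between Euclidean spaces. -/
noncomputable def specNorm {m n : ℕ} (M : Matrix (Fin m) (Fin n) ℝ) : ℝ :=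
  ‖LinearMap.toContinuousLinearMap (Matrix.toEuclideanLin M)‖

open scoped Matrix.Norms.L2Operator in
theorem specNorm_mul_le {l m n : ℕ} (M : Matrix (Fin l) (Fin m) ℝ)
    (N : Matrix (Fin m) (Fin n) ℝ) : specNorm (M * N) ≤ specNorm M * specNorm N :=
  Matrix.l2_opNorm_mul M N

theorem specNorm_nonneg {m n : ℕ} (M : Matrix (Fin m) (Fin n) ℝ) : 0 ≤ specNorm M :=
  norm_nonneg _

theorem specNorm_mul_mul_mul_le {m n p q r : ℕ} (M : Matrix (Fin m) (Fin n) ℝ)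
    (N : Matrix (Fin n) (Fin p) ℝ) (P : Matrix (Fin p) (Fin q) ℝ)
    (Q : Matrix (Fin q) (Fin r) ℝ) :
    specNorm (M * N * P * Q) ≤ specNorm M * specNorm N * specNorm P * specNorm Q :=
  calc specNorm (M * N * P * Q) ≤ specNorm (M * N * P) * specNorm Q := specNorm_mul_le _ _
    _ ≤ specNorm (M * N) * specNorm P * specNorm Q :=
      mul_le_mul_of_nonneg_right (specNorm_mul_le _ _) (specNorm_nonneg _)
    _ ≤ specNorm M * specNorm N * specNorm P * specNorm Q :=
      mul_le_mul_of_nonneg_right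
        (mul_le_mul_of_nonneg_right (specNorm_mul_le _ _) (specNorm_nonneg _))
        (specNorm_nonneg _)

/-- The factor `L` intertwines the Woodbury operator with `(A + L * R) * A⁻¹`. -/
theorem mul_woodbury {n k : ℕ} {A : Matrix (Fin n) (Fin n) ℝ} (hA : IsUnit A.det)
    (L : Matrix (Fin n) (Fin k) ℝ) (R : Matrix (Fin k) (Fin n) ℝ) :
    L * (1 + R * A⁻¹ * L) = (A + L * R) * A⁻¹ * L := by
  rw [Matrix.add_mul, Matrix.mul_nonsing_inv _ hA]
  simp only [Matrix.mul_add, Matrix.add_mul, Matrix.mul_one, Matrix.one_mul, Matrix.mul_assoc]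

theorem woodbury_eq {n k : ℕ} {A : Matrix (Fin n) (Fin n) ℝ} (hA : IsUnit A.det)
    {L : Matrix (Fin n) (Fin k) ℝ} {K : Matrix (Fin k) (Fin n) ℝ} (hK : K * L = 1)
    (R : Matrix (Fin k) (Fin n) ℝ) :
    1 + R * A⁻¹ * L = K * (A + L * R) * A⁻¹ * L := by
  rw [Matrix.mul_assoc K, Matrix.mul_assoc K, ← mul_woodbury hA, ← Matrix.mul_assoc, hK,
    Matrix.one_mul]

theorem inv_woodbury_eq {n k : ℕ} {A : Matrix (Fin n) (Fin n) ℝ} (hA : IsUnit A.det)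
    {L : Matrix (Fin n) (Fin k) ℝ} {K : Matrix (Fin k) (Fin n) ℝ} (hK : K * L = 1)
    {R : Matrix (Fin k) (Fin n) ℝ} (hB : IsUnit (A + L * R).det) :
    (1 + R * A⁻¹ * L)⁻¹ = K * A * (A + L * R)⁻¹ * L := by
  have hAB : A + L * R + L * -R = A := by simp
  have hX := woodbury_eq hB hK (-R)
  have hLX := mul_woodbury hB L (-R)
  rw [hAB] at hX hLX
  rw [← hX]
  apply Matrix.inv_eq_right_inv
  rw [woodbury_eq hA hK R, Matrix.mul_assoc _ L, hLX]
  simp only [Matrix.mul_assoc]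
  rw [Matrix.nonsing_inv_mul_cancel_left _ _ hA, Matrix.mul_nonsing_inv_cancel_left _ _ hB, hK]

/-- spectral-norm bounds `‖W‖ ≤ ‖L†‖·‖Â‖·‖Ã⁻¹‖·‖L‖` and
`‖W⁻¹‖ ≤ ‖L†‖·‖Â⁻¹‖·‖Ã‖·‖L‖` for the Woodbury operator `W = I + R·Ã⁻¹·L`. -/
theorem woodbury_norm_bounds {n k : ℕ}
    (Atil : Matrix (Fin n) (Fin n) ℝ)
    (L : Matrix (Fin n) (Fin k) ℝ) (R : Matrix (Fin k) (Fin n) ℝ)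
    (hA : IsUnit Atil.det) (hG : IsUnit (Lᵀ * L).det)
    (hAhat : IsUnit (Atil + L * R).det) :
    specNorm (1 + R * Atil⁻¹ * L) ≤
      specNorm ((Lᵀ * L)⁻¹ * Lᵀ) * specNorm (Atil + L * R) *
        specNorm Atil⁻¹ * specNorm L ∧
    specNorm (1 + R * Atil⁻¹ * L)⁻¹ ≤
      specNorm ((Lᵀ * L)⁻¹ * Lᵀ) * specNorm (Atil + L * R)⁻¹ *
        specNorm Atil * specNorm L := by
  have hK : (Lᵀ * L)⁻¹ * Lᵀ * L = 1 := by
    rw [Matrix.mul_assoc, Matrix.nonsing_inv_mul _ hG]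
  constructor
  · rw [woodbury_eq hA hK R]
    exact specNorm_mul_mul_mul_le _ _ _ _
  · rw [inv_woodbury_eq hA hK hAhat, mul_right_comm (specNorm _) (specNorm _⁻¹)]
    exact specNorm_mul_mul_mul_le _ _ _ _
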